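/- arXiv:1311.4450 — 3 statements merged into one kernel-verified Lean document; each statement's English description precedes it below -/
import Mathlib

section
/- Let X be a δ-hyperbolike graph with base vertex x, and let Y be a finite connected graph. Then the generating function b_Y(t) = Σ_{n≥0} (Y|X_n) tⁿ, whose n-th coefficient is the number of distinct embeddings of Y as a complete subgraph of the ball X_n, is a rational power series. -/
open SimpleGraph Filter

namespace CF

variable {V : Type*}

/-- A walk in a graph is a geodesic if its length realizes the graph distance
between its endpoints. -/
def IsGeodesic (G : SimpleGraph V) {u v : V} (p : G.Walk u v) : Prop :=
  p.length = G.dist u v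

/-- `G` is δ-hyperbolic: every geodesic triangle is δ-thin, i.e. each side lies
in the δ-neighborhood of the union of the other two sides. -/
def IsDeltaHyperbolic (G : SimpleGraph V) (δ : ℝ) : Prop :=
  ∀ ⦃a b c : V⦄ (p : G.Walk a b) (q : G.Walk b c) (r : G.Walk a c),
    IsGeodesic G p → IsGeodesic G q → IsGeodesic G r →
      (∀ z ∈ p.support, ∃ w, (w ∈ q.support ∨ w ∈ r.support) ∧ (G.dist z w : ℝ) ≤ δ) ∧
      (∀ z ∈ q.support, ∃ w, (w ∈ p.support ∨ w ∈ r.support) ∧ (G.dist z w : ℝ) ≤ δ) ∧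
      (∀ z ∈ r.support, ∃ w, (w ∈ p.support ∨ w ∈ q.support) ∧ (G.dist z w : ℝ) ≤ δ)

/-- `G` has uniformly finite valence. -/
def UnifFiniteValence (G : SimpleGraph V) : Prop :=
  ∃ D : ℕ, ∀ v : V, (G.neighborSet v).Finite ∧ (G.neighborSet v).ncard ≤ D

/-- The automorphism group of `G` acts transitively on vertices. -/
def VertexTransitive (G : SimpleGraph V) : Prop :=
  ∀ u v : V, ∃ φ : G ≃g G, φ u = v

/-- A δ-hyperbolike graph: connected, of uniformly finite valence, δ-hyperbolic
(with δ ≥ 0), and vertex-transitive. -/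
def Hyperbolike (G : SimpleGraph V) (δ : ℝ) : Prop :=
  G.Connected ∧ UnifFiniteValence G ∧ 0 ≤ δ ∧ IsDeltaHyperbolic G δ ∧ VertexTransitive G

/-- The ball of radius `n` about `x` (as a vertex set). -/
def ball (G : SimpleGraph V) (x : V) (n : ℕ) : Set V := {y | G.dist x y ≤ n}

/-- A formal power series over ℝ is rational if `q·P = p` for polynomials `p`, `q`
with `q(0) ≠ 0`. -/
def IsRationalPS (P : PowerSeries ℝ) : Prop :=
  ∃ p q : Polynomial ℝ, q.coeff 0 ≠ 0 ∧ (q : PowerSeries ℝ) * P = (p : PowerSeries ℝ)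

/-- Two geodesics starting at the same point `T`-synchronously fellow travel:
`d(γ(ℓ−i), γ′(ℓ′−i)) ≤ T` for all `0 ≤ i ≤ min(ℓ,ℓ′)`. -/
def SyncFellowTravel (G : SimpleGraph V) (T : ℝ) {x y z : V}
    (p : G.Walk x y) (q : G.Walk x z) : Prop :=
  ∀ i : ℕ, i ≤ min p.length q.length →
    (G.dist (p.getVert (p.length - i)) (q.getVert (q.length - i)) : ℝ) ≤ T

/-- `z` is a competitor of `y` (with respect to the base point `x`):
`z ∈ B_{2δ+1}(y)`, `d(x,z) ≤ d(x,y)`, and some geodesic from `x` to `z`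
`(2δ+1)`-synchronously fellow travels every geodesic from `x` to `y`. -/
def Competitor (G : SimpleGraph V) (δ : ℝ) (x y z : V) : Prop :=
  (G.dist y z : ℝ) ≤ 2*δ+1 ∧ G.dist x z ≤ G.dist x y ∧
  ∃ p : G.Walk x z, IsGeodesic G p ∧
    ∀ q : G.Walk x y, IsGeodesic G q → SyncFellowTravel G (2*δ+1) p q

/-- `F` is a tournament at `y` (with base point `x`); only the values of `F` on
the ball `B_{2δ+1}(y)` are constrained. -/
def Tournament (G : SimpleGraph V) (δ : ℝ) (x y : V) (F : V → ℤ) : Prop :=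
  (∀ z : V, (G.dist y z : ℝ) ≤ 2*δ+1 →
    (G.dist x z : ℤ) - (G.dist x y : ℤ) ≤ F z ∧ F z ≤ (G.dist y z : ℤ)) ∧
  (∀ z : V, Competitor G δ x y z → (G.dist x z : ℤ) = (G.dist x y : ℤ) + F z)

/-- Tournaments `(y,F)` and `(y',F')` have the same type: some automorphism `φ`
carries `y` to `y'` with `F = F' ∘ φ` (on the ball `B_{2δ+1}(y)`). -/
def SameTournamentType (G : SimpleGraph V) (δ : ℝ) (y y' : V) (F F' : V → ℤ) : Prop :=
  ∃ φ : G ≃g G, φ y = y' ∧ ∀ z : V, (G.dist y z : ℝ) ≤ 2*δ+1 → F z = F' (φ z)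

/-- The cone of `y` with respect to the base point `x`. -/
def cone (G : SimpleGraph V) (x y : V) : Set V :=
  {z | G.dist x z = G.dist x y + G.dist y z}

/-- There is a quasi-isometry from the vertices of `G` (with the path metric) to ℝ. -/
def QuasiIsometricToReal (G : SimpleGraph V) : Prop :=
  ∃ (f : V → ℝ) (C : ℝ), 1 ≤ C ∧
    (∀ u v : V, (G.dist u v : ℝ)/C - C ≤ |f u - f v| ∧ |f u - f v| ≤ C * G.dist u v + C) ∧
    (∀ r : ℝ, ∃ v : V, |r - f v| ≤ C)

/-- `G` is nonelementary: infinitely many vertices and not quasi-isometric to ℝ. -/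
def Nonelementary (G : SimpleGraph V) : Prop :=
  Infinite V ∧ ¬ QuasiIsometricToReal G

/-- `ω` is an opposite series of the power series with (positive) coefficients `a`:
the polynomials `Xₙ(P)(s) = Σ_{k≤n} (a_{n-k}/aₙ) s^k` accumulate coefficientwise at `ω`
along some strictly increasing sequence of indices. -/
def OppositeSeries (a : ℕ → ℝ) (ω : ℕ → ℝ) : Prop :=
  ∃ φ : ℕ → ℕ, StrictMono φ ∧
    ∀ k : ℕ, Tendsto (fun j => a (φ j - k) / a (φ j)) atTop (nhds (ω k))

end CF

namespace CF

section Geometry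

variable {V : Type*} {G : SimpleGraph V}

lemma dist_iso (hc : G.Connected) (φ : G ≃g G) (u v : V) :
    G.dist (φ u) (φ v) = G.dist u v := by
  have key : ∀ (ψ : G ≃g G) (a b : V), G.dist (ψ a) (ψ b) ≤ G.dist a b := by
    intro ψ a b
    obtain ⟨p, hp⟩ := hc.exists_walk_length_eq_dist a b
    have h := dist_le (p.map ψ.toHom)
    rw [Walk.length_map, hp] at h
    exact h
  refine le_antisymm (key φ u v) ?_
  simpa using key φ.symm (φ u) (φ v)

lemma finite_ball (hc : G.Connected) (hv : UnifFiniteValence G) (y : V) (n : ℕ) :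
    (ball G y n).Finite := by
  obtain ⟨D, hD⟩ := hv
  induction n with
  | zero =>
    refine (Set.finite_singleton y).subset fun z hz => ?_
    have hz' : G.dist y z = 0 := Nat.le_zero.mp hz
    exact (hc.dist_eq_zero_iff.mp hz').symm
  | succ n ih =>
    refine (ih.union (ih.biUnion fun z _ => (hD z).1)).subset fun z hz => ?_
    rcases Nat.lt_or_ge n (G.dist y z) with h | h
    · obtain ⟨p, hp⟩ := hc.exists_walk_length_eq_dist z y
      cases p with
      | nil => simp at h
      | @cons _ w _ hadj q =>
        have h1 := dist_le q
        rw [Walk.length_cons, dist_comm] at hp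
        have h2 : G.dist y z ≤ n + 1 := hz
        refine Or.inr (Set.mem_biUnion (x := w) ?_ hadj.symm)
        change G.dist y w ≤ n
        rw [dist_comm]
        omega
    · exact Or.inl h

lemma dist_add_dist_of_mem_support {u v w : V} (hc : G.Connected) {p : G.Walk u v}
    (hp : p.length = G.dist u v) (hw : w ∈ p.support) :
    G.dist u w + G.dist w v = G.dist u v := by
  classical
  have h1 := dist_le (p.takeUntil w hw)
  have h2 := dist_le (p.dropUntil w hw)
  have h3 := congrArg Walk.length (p.take_spec hw)
  rw [Walk.length_append] at h3
  have h4 := hc.dist_triangle (u := u) (v := w) (w := v)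
  omega

lemma exists_intermediate (hc : G.Connected) (u v : V) {i : ℕ} (hi : i ≤ G.dist u v) :
    ∃ w, G.dist u w = i ∧ G.dist w v + i = G.dist u v := by
  obtain ⟨p, hp⟩ := hc.exists_walk_length_eq_dist u v
  have h1 := dist_le (p.take i)
  have h2 := dist_le (p.drop i)
  have h3 := hc.dist_triangle (u := u) (v := p.getVert i) (w := v)
  rw [Walk.take_length] at h1
  rw [Walk.drop_length] at h2
  exact ⟨p.getVert i, by omega, by omega⟩

/-- If `y` lies on a geodesic from `x` to `y'`, far enough from `y'` compared with `z`, then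
every geodesic from `x` to `z` passes close to `y`; here such a geodesic is taken through a
prescribed intermediate vertex `v`. -/
lemma exists_near_on_geodesic {δ : ℝ} {r : ℕ} (hc : G.Connected) (hδ : IsDeltaHyperbolic G δ)
    (hr : δ ≤ r) {x y y' z v : V} (hy : G.dist x y + G.dist y y' = G.dist x y')
    (hv : G.dist x v + G.dist v z = G.dist x z) (hz : G.dist y' z + r < G.dist y y') :
    ∃ w, G.dist y w ≤ r ∧ G.dist x w + G.dist w z = G.dist x z ∧
      (G.dist x w + G.dist w v = G.dist x v ∨ G.dist v w + G.dist w z = G.dist v z) := by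
  obtain ⟨p₁, hp₁⟩ := hc.exists_walk_length_eq_dist x y
  obtain ⟨p₂, hp₂⟩ := hc.exists_walk_length_eq_dist y y'
  obtain ⟨q, hq⟩ := hc.exists_walk_length_eq_dist y' z
  obtain ⟨r₁, hr₁⟩ := hc.exists_walk_length_eq_dist x v
  obtain ⟨r₂, hr₂⟩ := hc.exists_walk_length_eq_dist v z
  have hr₀ : (r₁.append r₂).length = G.dist x z := by rw [Walk.length_append]; omega
  obtain ⟨w, hw, hd⟩ := (hδ (p₁.append p₂) q (r₁.append r₂)
    (by unfold IsGeodesic; rw [Walk.length_append]; omega) hq hr₀).1 y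
    (by rw [Walk.mem_support_append_iff]; exact Or.inl p₁.end_mem_support)
  have hd' : G.dist y w ≤ r := by exact_mod_cast hd.trans hr
  rcases hw with hw | hw
  · have h1 := dist_add_dist_of_mem_support hc hq hw
    have h2 := hc.dist_triangle (u := y) (v := w) (w := y')
    rw [dist_comm (u := w) (v := y')] at h2
    omega
  · refine ⟨w, hd', dist_add_dist_of_mem_support hc hr₀ hw, ?_⟩
    rw [Walk.mem_support_append_iff] at hw
    exact hw.imp (dist_add_dist_of_mem_support hc hr₁) (dist_add_dist_of_mem_support hc hr₂)

/-- `φ` carries the function `d(x,·) - d(x,y)` on the ball of radius `R` about `y` to the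
corresponding function about `φ y`. -/
def PreservesLocalType (G : SimpleGraph V) (x : V) (R : ℕ) (φ : G ≃g G) (y : V) : Prop :=
  ∀ z, G.dist y z ≤ R → G.dist x (φ z) + G.dist x y = G.dist x z + G.dist x (φ y)

lemma PreservesLocalType.symm (hc : G.Connected) {x y : V} {R : ℕ} {φ : G ≃g G}
    (h : PreservesLocalType G x R φ y) : PreservesLocalType G x R φ.symm (φ y) := by
  intro z hz
  have h1 := h (φ.symm z) (by rw [← dist_iso hc φ]; simpa using hz)
  simp only [RelIso.apply_symm_apply, RelIso.symm_apply_apply] at h1 ⊢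
  omega

lemma PreservesLocalType.trans (hc : G.Connected) {x y : V} {R : ℕ} {φ ψ : G ≃g G}
    (h : PreservesLocalType G x R φ y) (h' : PreservesLocalType G x R ψ (φ y)) :
    PreservesLocalType G x R (φ.trans ψ) y := by
  intro z hz
  have h1 := h z hz
  have h2 := h' (φ z) (by rwa [dist_iso hc])
  simp only [RelIso.trans_apply]
  omega

/-- The local type of radius `r + 2` determines the cone. -/
lemma PreservesLocalType.cone {δ : ℝ} {r R : ℕ} (hc : G.Connected)
    (hδ : IsDeltaHyperbolic G δ) (hr : δ ≤ r) (hR : r + 2 ≤ R) {x y : V} {φ : G ≃g G}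
    (h : PreservesLocalType G x R φ y) {u : V} (hu : G.dist x y + G.dist y u = G.dist x u) :
    G.dist x (φ y) + G.dist y u = G.dist x (φ u) := by
  obtain ⟨n, hn⟩ : ∃ n, G.dist y u = n := ⟨_, rfl⟩
  induction n generalizing u with
  | zero =>
    obtain rfl := hc.dist_eq_zero_iff.mp hn
    omega
  | succ n ih =>
    obtain ⟨t, ht1, ht2⟩ := exists_intermediate hc y u (i := n) (by omega)
    have htu : G.dist t u = 1 := by omega
    have h1 := hc.dist_triangle (u := x) (v := y) (w := t)
    have h2 := hc.dist_triangle (u := x) (v := t) (w := u)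
    have h3 := ih (u := t) (by omega) ht1
    have h4 := hc.dist_triangle (u := x) (v := φ y) (w := φ u)
    rw [dist_iso hc] at h4
    by_cases hnr : n ≤ 1 + r
    · have := h u (by omega)
      omega
    · obtain ⟨w, hw1, hw2, -⟩ := exists_near_on_geodesic hc hδ hr (x := x) (y := φ y)
        (y' := φ t) (z := φ u) (v := x) (by rw [dist_iso hc]; omega) (by simp)
        (by rw [dist_iso hc, dist_iso hc]; omega)
      obtain ⟨w, rfl⟩ := φ.surjective w
      rw [dist_iso hc] at hw1 hw2
      have h5 := h w (by omega)
      have h6 := hc.dist_triangle (u := x) (v := w) (w := u)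
      omega

/-- Far out in the cone of `y`, local types are determined by the local type of `y`. -/
lemma PreservesLocalType.descend {δ : ℝ} {r R : ℕ} (hc : G.Connected)
    (hδ : IsDeltaHyperbolic G δ) (hr : δ ≤ r) (hR : r + 2 ≤ R) {x y : V} {φ : G ≃g G}
    (h : PreservesLocalType G x R φ y) {u : V} (hu : G.dist x y + G.dist y u = G.dist x u)
    (hyu : R + r < G.dist y u) : PreservesLocalType G x R φ u := by
  have key : ∀ (ψ : G ≃g G) (y u : V), PreservesLocalType G x R ψ y →
      G.dist x y + G.dist y u = G.dist x u → R + r < G.dist y u →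
      ∀ z, G.dist u z ≤ R → G.dist x (ψ z) + G.dist x u ≤ G.dist x z + G.dist x (ψ u) := by
    intro ψ y u h hu hyu z hz
    obtain ⟨w, hw1, hw2, -⟩ := exists_near_on_geodesic hc hδ hr (z := z) (v := x) hu (by simp)
      (by omega)
    have h1 := h w (by omega)
    have h2 := h.cone hc hδ hr hR hu
    have h3 := hc.dist_triangle (u := x) (v := ψ w) (w := ψ z)
    rw [dist_iso hc] at h3
    omega
  intro z hz
  refine le_antisymm (key φ y u h hu hyu z hz) ?_
  have h2 := h.cone hc hδ hr hR hu
  have := key φ.symm (φ y) (φ u) (h.symm hc) (by rw [dist_iso hc]; exact h2)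
    (by rwa [dist_iso hc]) (φ z) (by rwa [dist_iso hc])
  simp only [RelIso.symm_apply_apply] at this
  omega

/-- The vertices `K` steps before `u` on geodesics from `x` to `u`. -/
def ancestors (G : SimpleGraph V) (x : V) (K : ℕ) (u : V) : Set V :=
  {v | G.dist x v + K = G.dist x u ∧ G.dist v u = K}

lemma map_ancestors_subset {δ : ℝ} {r R K : ℕ} (hc : G.Connected)
    (hδ : IsDeltaHyperbolic G δ) (hr : δ ≤ r) (hR : 2 * r + 2 ≤ R) (hK : r < K)
    {x y u : V} {φ : G ≃g G} (h : PreservesLocalType G x R φ y) (hu : y ∈ ancestors G x K u) :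
    Set.MapsTo φ (ancestors G x K u) (ancestors G x K (φ u)) := by
  rintro v ⟨hv1, hv2⟩
  obtain ⟨hu1, hu2⟩ := hu
  obtain ⟨w, hw1, hw2, hw3⟩ := exists_near_on_geodesic hc hδ hr (x := x) (y := y) (y' := u)
    (z := u) (v := v) (by omega) (by omega) (by simp; omega)
  have h1 := hc.dist_triangle (u := x) (v := y) (w := w)
  have h2 := hc.dist_triangle (u := x) (v := w) (w := y)
  have h3 := hc.dist_triangle (u := y) (v := w) (w := v)
  have h4 := h.cone hc hδ hr (by omega) (u := u) (by omega)
  rw [dist_comm (u := w) (v := y)] at h2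
  have h5 : G.dist y v ≤ R := by
    rcases hw3 with hw3 | hw3
    · omega
    · rw [dist_comm (u := v) (v := w)] at hw3
      omega
  have h6 := h v h5
  exact ⟨by omega, by rw [dist_iso hc]; exact hv2⟩

lemma ncard_ancestors_map {δ : ℝ} {r R K : ℕ} (hc : G.Connected) (hv : UnifFiniteValence G)
    (hδ : IsDeltaHyperbolic G δ) (hr : δ ≤ r) (hR : 2 * r + 2 ≤ R) (hK : r < K)
    {x y u : V} {φ : G ≃g G} (h : PreservesLocalType G x R φ y) (hu : y ∈ ancestors G x K u) :
    (ancestors G x K (φ u)).ncard = (ancestors G x K u).ncard := by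
  have hfin : ∀ u, (ancestors G x K u).Finite := fun u =>
    (finite_ball hc hv x (G.dist x u)).subset fun v hv => by
      have := hv.1
      change G.dist x v ≤ _
      omega
  have h1 := map_ancestors_subset hc hδ hr hR hK h hu
  have h2 := map_ancestors_subset hc hδ hr hR hK (h.symm hc) (h1 hu)
  rw [RelIso.symm_apply_apply] at h2
  exact le_antisymm
    (Set.ncard_le_ncard_of_injOn _ h2 φ.symm.injective.injOn (hfin _))
    (Set.ncard_le_ncard_of_injOn _ h1 φ.injective.injOn (hfin _))

/-- Vertices are equivalent when some automorphism matches their local types. -/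
def localTypeSetoid (hc : G.Connected) (x : V) (R : ℕ) : Setoid V where
  r y y' := ∃ φ : G ≃g G, φ y = y' ∧ PreservesLocalType G x R φ y
  iseqv := {
    refl := fun y => ⟨RelIso.refl _, rfl, fun z _ => rfl⟩
    symm := by
      rintro y _ ⟨φ, rfl, h⟩
      exact ⟨φ.symm, by simp, h.symm hc⟩
    trans := by
      rintro y _ _ ⟨φ, rfl, h⟩ ⟨ψ, rfl, h'⟩
      exact ⟨φ.trans ψ, rfl, h.trans hc h'⟩ }

lemma finite_localTypes (hc : G.Connected) (hv : UnifFiniteValence G)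
    (ht : VertexTransitive G) (x : V) (R : ℕ) : Finite (Quotient (localTypeSetoid hc x R)) := by
  choose φ hφ using fun y => ht x y
  have : Finite (ball G x R) := finite_ball hc hv x R
  let f : V → (ball G x R → Fin (2 * R + 1)) := fun y z =>
    ⟨G.dist x (φ y z) + R - G.dist x y, by
      have h1 := hc.dist_triangle (u := x) (v := y) (w := φ y z)
      have h2 := dist_iso hc (φ y) x z
      have h3 : G.dist x z ≤ R := z.2
      rw [hφ] at h2
      omega⟩
  refine Finite.of_injective (fun q : Quotient (localTypeSetoid hc x R) => f q.out) ?_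
  intro q q' hqq
  rw [← q.out_eq, ← q'.out_eq]
  refine Quotient.sound ⟨(φ q.out).symm.trans (φ q'.out), ?_, ?_⟩
  · rw [RelIso.trans_apply, (RelIso.symm_apply_eq (φ q.out)).mpr (hφ q.out).symm, hφ]
  · intro z hz
    obtain ⟨z, rfl⟩ := (φ q.out).surjective z
    have hx : (φ q.out).symm q.out = x := by
      rw [RelIso.symm_apply_eq, hφ]
    have hz' : G.dist x z ≤ R := by
      rwa [← dist_iso hc (φ q.out), hφ]
    have h1 := congrArg Fin.val (congrFun hqq ⟨z, hz'⟩)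
    simp only [f] at h1
    have h2 := hc.dist_triangle (u := x) (v := φ q.out z) (w := q.out)
    have h3 := hc.dist_triangle (u := x) (v := φ q'.out z) (w := q'.out)
    have h4 := dist_iso hc (φ q'.out) x z
    rw [hφ] at h4
    rw [dist_comm] at h4 hz
    simp only [RelIso.trans_apply, RelIso.symm_apply_apply, hx, hφ]
    omega

end Geometry

section Rational

lemma IsRationalPS.coe (p : Polynomial ℝ) : IsRationalPS (p : PowerSeries ℝ) :=
  ⟨p, 1, by simp, by simp⟩

lemma IsRationalPS.add {P Q : PowerSeries ℝ} (hP : IsRationalPS P) (hQ : IsRationalPS Q) :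
    IsRationalPS (P + Q) := by
  obtain ⟨p, q, hq, h⟩ := hP
  obtain ⟨p', q', hq', h'⟩ := hQ
  refine ⟨p * q' + p' * q, q * q', by simp [Polynomial.mul_coeff_zero, hq, hq'], ?_⟩
  push_cast
  rw [← h, ← h']
  ring

lemma IsRationalPS.mul {P Q : PowerSeries ℝ} (hP : IsRationalPS P) (hQ : IsRationalPS Q) :
    IsRationalPS (P * Q) := by
  obtain ⟨p, q, hq, h⟩ := hP
  obtain ⟨p', q', hq', h'⟩ := hQ
  refine ⟨p * p', q * q', by simp [Polynomial.mul_coeff_zero, hq, hq'], ?_⟩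
  push_cast
  rw [← h, ← h']
  ring

lemma IsRationalPS.sum {ι : Type*} (s : Finset ι) {P : ι → PowerSeries ℝ}
    (h : ∀ i ∈ s, IsRationalPS (P i)) : IsRationalPS (∑ i ∈ s, P i) :=
  Finset.sum_induction _ _ (fun _ _ => IsRationalPS.add) (by simpa using IsRationalPS.coe 0) h

/-- Coordinates of a vector sequence with `N (n + K) = C N n` have rational generating
functions. -/
lemma isRationalPS_of_transfer {Q : Type*} [Fintype Q] (K : ℕ) (hK : 0 < K)
    (C : Matrix Q Q ℝ) (N : ℕ → Q → ℝ) (h : ∀ n, N (n + K) = C.mulVec (N n)) (i : Q) :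
    IsRationalPS (PowerSeries.mk fun n => N n i) := by
  classical
  let f := Polynomial.coeToPowerSeries.ringHom (R := ℝ)
  let A : Matrix Q Q (Polynomial ℝ) :=
    1 - (Polynomial.X ^ K : Polynomial ℝ) • C.map Polynomial.C
  let F : Q → PowerSeries ℝ := fun j => PowerSeries.mk fun n => N n j
  let p : Q → Polynomial ℝ := fun j => PowerSeries.trunc K (F j)
  have hA : (f.mapMatrix A).mulVec F = f ∘ p := by
    ext j n
    have hfA : f.mapMatrix A = 1 - (PowerSeries.X ^ K : PowerSeries ℝ) • C.map PowerSeries.C := by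
      ext a b : 2
      simp only [A, f, map_sub, map_one, RingHom.mapMatrix_apply, Matrix.sub_apply,
        Matrix.map_apply, Matrix.smul_apply, smul_eq_mul, map_mul,
        Polynomial.coeToPowerSeries.ringHom_apply, Polynomial.coe_pow, Polynomial.coe_X,
        Polynomial.coe_C]
    rw [hfA, Matrix.sub_mulVec, Matrix.one_mulVec, Matrix.smul_mulVec, Pi.sub_apply,
      Pi.smul_apply, smul_eq_mul, map_sub, PowerSeries.coeff_X_pow_mul']
    simp only [Function.comp_apply, f, p, Polynomial.coeToPowerSeries.ringHom_apply,
      Polynomial.coeff_coe, PowerSeries.coeff_trunc]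
    by_cases hn : n < K
    · rw [if_neg (Nat.not_le.mpr hn), if_pos hn, sub_zero]
    · obtain ⟨m, rfl⟩ := Nat.exists_eq_add_of_le (Nat.not_lt.mp hn)
      have h1 := congrFun (h m) j
      rw [add_comm m K] at h1
      rw [if_pos (Nat.le_add_right K m), if_neg hn, Nat.add_sub_cancel_left]
      simp only [F, Matrix.mulVec, dotProduct, map_sum, Matrix.map_apply, PowerSeries.coeff_C_mul,
        PowerSeries.coeff_mk] at h1 ⊢
      rw [h1, sub_self]
  refine ⟨A.adjugate.mulVec p i, A.det, ?_, ?_⟩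
  · have h0 : (Polynomial.evalRingHom (0 : ℝ)).mapMatrix A = 1 := by
      ext a b
      simp [A, Matrix.one_apply, apply_ite, hK.ne']
    rw [Polynomial.coeff_zero_eq_eval_zero, ← Polynomial.coe_evalRingHom, RingHom.map_det, h0]
    simp
  · change f A.det * F i = f (A.adjugate.mulVec p i)
    rw [RingHom.map_mulVec, ← RingHom.mapMatrix_apply, RingHom.map_adjugate, ← hA,
      Matrix.mulVec_mulVec, Matrix.adjugate_mul, RingHom.map_det, Matrix.smul_mulVec,
      Matrix.one_mulVec, Pi.smul_apply, smul_eq_mul]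

lemma isRationalPS_of_eventually_const (a : ℕ → ℝ) (R : ℕ) (h : ∀ k, R ≤ k → a k = a R) :
    IsRationalPS (PowerSeries.mk a) := by
  refine ⟨PowerSeries.trunc (R + 1) ((1 - PowerSeries.X) * PowerSeries.mk a),
    1 - Polynomial.X, by simp, ?_⟩
  ext n
  rw [Polynomial.coeff_coe, PowerSeries.coeff_trunc]
  push_cast
  split_ifs with hn
  · rfl
  · obtain ⟨m, rfl⟩ : ∃ m, n = m + 1 := ⟨n - 1, by omega⟩
    rw [sub_mul, one_mul, map_sub, PowerSeries.coeff_succ_X_mul, PowerSeries.coeff_mk,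
      PowerSeries.coeff_mk, h m (by omega), h (m + 1) (by omega), sub_self]

end Rational

section Counting

variable {V : Type*} {G : SimpleGraph V}

open Classical in
lemma exists_transfer {δ : ℝ} {r R K : ℕ} (hc : G.Connected) (hv : UnifFiniteValence G)
    (hδ : IsDeltaHyperbolic G δ) (hr : δ ≤ r) (hR : 2 * r + 2 ≤ R) (hK : R + r < K) (x : V)
    (S : ℕ → Finset V) (hS : ∀ n u, u ∈ S n ↔ G.dist x u = n)
    [Fintype (Quotient (localTypeSetoid hc x R))] :
    ∃ C : Matrix (Quotient (localTypeSetoid hc x R)) (Quotient (localTypeSetoid hc x R)) ℝ,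
      ∀ n, (fun τ => ({y ∈ S (n + K) | Quotient.mk _ y = τ}.card : ℝ)) =
        C.mulVec fun τ => ({y ∈ S n | Quotient.mk _ y = τ}.card : ℝ) := by
  let T : V → Quotient (localTypeSetoid hc x R) := Quotient.mk _
  let c : V → Quotient (localTypeSetoid hc x R) → ℝ := fun y τ =>
    ∑ u ∈ S (G.dist x y + K) with (y ∈ ancestors G x K u ∧ T u = τ),
      ((ancestors G x K u).ncard : ℝ)⁻¹
  have hmap : ∀ (φ : G ≃g G) (y : V), PreservesLocalType G x R φ y → ∀ u,
      y ∈ ancestors G x K u → φ y ∈ ancestors G x K (φ u) ∧ T (φ u) = T u := by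
    intro φ y h u hu
    refine ⟨map_ancestors_subset hc hδ hr hR (by omega) h hu hu, ?_⟩
    have h' : PreservesLocalType G x R φ u :=
      h.descend hc hδ hr (by omega) (by rw [hu.2, hu.1]) (by rw [hu.2]; exact hK)
    exact (Quotient.sound (s := localTypeSetoid hc x R) ⟨φ, rfl, h'⟩).symm
  have hcT : ∀ y y' τ, T y = T y' → c y τ = c y' τ := by
    intro y y' τ hyy
    obtain ⟨φ, rfl, h⟩ := Quotient.exact hyy
    refine Finset.sum_bij' (fun u _ => φ u) (fun u _ => φ.symm u) ?_ ?_ ?_ ?_ ?_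
    · intro u hu
      simp only [Finset.mem_filter, hS] at hu ⊢
      obtain ⟨h1, h2⟩ := hmap φ y h u hu.2.1
      exact ⟨h1.1.symm, h1, h2.trans hu.2.2⟩
    · intro u hu
      simp only [Finset.mem_filter, hS] at hu ⊢
      obtain ⟨h1, h2⟩ := hmap φ.symm (φ y) (h.symm hc) u hu.2.1
      rw [RelIso.symm_apply_apply] at h1
      exact ⟨h1.1.symm, h1, h2.trans hu.2.2⟩
    · intro u _
      simp
    · intro u _
      simp
    · intro u hu
      rw [Finset.mem_filter] at hu
      rw [ncard_ancestors_map hc hv hδ hr hR (by omega) h hu.2.1]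
  refine ⟨fun τ σ => c σ.out τ, fun n => funext fun τ => ?_⟩
  have hone : ∀ u ∈ S (n + K),
      ∑ y ∈ S n with y ∈ ancestors G x K u, ((ancestors G x K u).ncard : ℝ)⁻¹ = 1 := by
    intro u hu
    rw [hS] at hu
    have hset : ({y ∈ S n | y ∈ ancestors G x K u} : Finset V) = ancestors G x K u := by
      ext y
      simp only [Finset.coe_filter, Set.mem_ofPred_eq, hS, and_iff_right_iff_imp]
      intro hy
      have := hy.1
      omega
    rw [Finset.sum_const, ← Set.ncard_coe_finset, hset, nsmul_eq_mul]
    refine mul_inv_cancel₀ (Nat.cast_ne_zero.mpr ?_)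
    rw [← hset, Set.ncard_coe_finset]
    obtain ⟨w, hw1, hw2⟩ := exists_intermediate hc x u (i := n) (by omega)
    refine (Finset.card_pos.mpr ⟨w, ?_⟩).ne'
    rw [Finset.mem_filter, hS]
    exact ⟨hw1, by omega, by omega⟩
  calc ({u ∈ S (n + K) | T u = τ}.card : ℝ)
      = ∑ u ∈ S (n + K) with T u = τ, ∑ y ∈ S n with y ∈ ancestors G x K u,
          ((ancestors G x K u).ncard : ℝ)⁻¹ := by
        rw [Finset.sum_congr rfl fun u hu => hone u (Finset.mem_filter.mp hu).1]
        simp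
    _ = ∑ y ∈ S n, ∑ u ∈ S (n + K) with (y ∈ ancestors G x K u ∧ T u = τ),
          ((ancestors G x K u).ncard : ℝ)⁻¹ :=
        Finset.sum_comm' fun u y => by
          simp only [Finset.mem_filter]
          tauto
    _ = ∑ y ∈ S n, c y τ := Finset.sum_congr rfl fun y hy => by
        simp only [c]
        rw [(hS n y).mp hy]
    _ = ∑ σ, ∑ y ∈ S n with T y = σ, c y τ := (Finset.sum_fiberwise _ _ _).symm
    _ = ∑ σ, c σ.out τ * ({y ∈ S n | T y = σ}.card : ℝ) := by
        refine Finset.sum_congr rfl fun σ _ => ?_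
        rw [Finset.sum_congr rfl fun y hy => hcT y σ.out τ
          ((Finset.mem_filter.mp hy).2.trans σ.out_eq.symm), Finset.sum_const, nsmul_eq_mul,
          mul_comm]

/-- The number of embeddings of `H` sending `w₀` to `y` with image at most `k` further from `x`
than `y`. -/
noncomputable def rootedCount {W : Type*} (G : SimpleGraph V) (H : SimpleGraph W) (x : V)
    (w₀ : W) (y : V) (k : ℕ) : ℕ :=
  Nat.card {ι : H ↪g G // ι w₀ = y ∧ ∀ w, G.dist x (ι w) ≤ G.dist x y + k}

lemma dist_embedding_le {W : Type*} [Fintype W] {H : SimpleGraph W} (hH : H.Connected)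
    (ι : H ↪g G) (a b : W) : G.dist (ι a) (ι b) ≤ Fintype.card W := by
  obtain ⟨p, hp, -⟩ := hH.exists_path_of_dist a b
  have h := dist_le (p.map ι.toHom)
  rw [Walk.length_map] at h
  exact h.trans hp.length_lt.le

lemma rootedCount_eq {W : Type*} [Fintype W] {H : SimpleGraph W} (hc : G.Connected)
    (hH : H.Connected) {x y : V} {R : ℕ} (hR : Fintype.card W ≤ R) {φ : G ≃g G}
    (h : PreservesLocalType G x R φ y) (w₀ : W) (k : ℕ) :
    rootedCount G H x w₀ (φ y) k = rootedCount G H x w₀ y k := by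
  have key : ∀ (ψ : G ≃g G) (y : V), PreservesLocalType G x R ψ y → ∀ ι : H ↪g G,
      (ι w₀ = y ∧ ∀ w, G.dist x (ι w) ≤ G.dist x y + k) →
      (ψ (ι w₀) = ψ y ∧ ∀ w, G.dist x (ψ (ι w)) ≤ G.dist x (ψ y) + k) := by
    rintro ψ _ h ι ⟨rfl, hι⟩
    refine ⟨rfl, fun w => ?_⟩
    have h1 := h (ι w) ((dist_embedding_le hH ι w₀ w).trans hR)
    have h2 := hι w
    omega
  refine Nat.card_congr
    { toFun := fun ι => ⟨φ.symm.toEmbedding.comp ι.1, ?_⟩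
      invFun := fun ι => ⟨φ.toEmbedding.comp ι.1, key φ y h ι.1 ι.2⟩
      left_inv := fun ι => ?_
      right_inv := fun ι => ?_ }
  · have := key φ.symm (φ y) (h.symm hc) ι.1 ι.2
    rwa [RelIso.symm_apply_apply] at this
  · ext w
    exact φ.apply_symm_apply _
  · ext w
    exact φ.symm_apply_apply _

lemma rootedCount_of_le {W : Type*} [Fintype W] {H : SimpleGraph W} (hc : G.Connected)
    (hH : H.Connected) (x y : V) {R k : ℕ} (hR : Fintype.card W ≤ R) (hk : R ≤ k) (w₀ : W) :
    rootedCount G H x w₀ y k = rootedCount G H x w₀ y R := by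
  refine Nat.card_congr (Equiv.subtypeEquivRight fun ι => and_congr_right ?_)
  rintro rfl
  have h : ∀ w, G.dist x (ι w) ≤ G.dist x (ι w₀) + R := fun w => by
    have h1 := dist_embedding_le hH ι w₀ w
    have h2 := hc.dist_triangle (u := x) (v := ι w₀) (w := ι w)
    omega
  exact ⟨fun _ => h, fun _ w => (h w).trans (by omega)⟩

lemma card_embedding_ball {W : Type*} [Fintype W] (H : SimpleGraph W) (hc : G.Connected)
    (hv : UnifFiniteValence G) (x : V) (w₀ : W)
    (S : ℕ → Finset V) (hS : ∀ n u, u ∈ S n ↔ G.dist x u = n) (n : ℕ) :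
    Nat.card (H ↪g G.induce (ball G x n)) =
      ∑ m ∈ Finset.range (n + 1), ∑ y ∈ S m, rootedCount G H x w₀ y (n - m) := by
  have hfin : Finite (ball G x n) := finite_ball hc hv x n
  have hE : Finite (H ↪g G.induce (ball G x n)) := DFunLike.finite _
  let e : (H ↪g G.induce (ball G x n)) ≃
      Σ p : (Finset.range (n + 1)).sigma S,
        {ι : H ↪g G // ι w₀ = p.1.2 ∧ ∀ w, G.dist x (ι w) ≤ G.dist x p.1.2 + (n - p.1.1)} :=
    { toFun := fun ι => ⟨⟨⟨G.dist x (ι w₀), ι w₀⟩, by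
        have : G.dist x (ι w₀) ≤ n := (ι w₀).2
        rw [Finset.mem_sigma, Finset.mem_range, hS]
        exact ⟨Nat.lt_succ_of_le this, rfl⟩⟩, (Embedding.induce _).comp ι, rfl, fun w => by
        have : G.dist x (ι w) ≤ n := (ι w).2
        change G.dist x (ι w) ≤ G.dist x (ι w₀) + (n - G.dist x (ι w₀))
        omega⟩
      invFun := fun q =>
        { toFun := fun w => ⟨q.2.1 w, by
            have h1 := Finset.mem_sigma.mp q.1.2
            rw [Finset.mem_range, hS] at h1
            have h2 := q.2.2.2 w
            change G.dist x _ ≤ n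
            omega⟩
          inj' := fun a b hab => q.2.1.injective (congrArg Subtype.val hab)
          map_rel_iff' := q.2.1.map_rel_iff }
      left_inv := fun ι => rfl
      right_inv := by
        rintro ⟨⟨⟨m, y⟩, hp⟩, ι, hy, hι⟩
        dsimp only at hy
        subst hy
        have hm := (Finset.mem_sigma.mp hp).2
        rw [hS] at hm
        dsimp only at hm
        subst hm
        rfl }
  have hF : ∀ p : (Finset.range (n + 1)).sigma S, Finite
      {ι : H ↪g G // ι w₀ = p.1.2 ∧ ∀ w, G.dist x (ι w) ≤ G.dist x p.1.2 + (n - p.1.1)} :=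
    fun p => Finite.of_injective (fun ι => e.symm ⟨p, ι⟩)
      (e.symm.injective.comp sigma_mk_injective)
  rw [Nat.card_congr e, Nat.card_sigma, Finset.sum_sigma',
    ← Finset.sum_coe_sort ((Finset.range (n + 1)).sigma S)]
  rfl

end Counting

/-- Rationality: for a δ-hyperbolike graph `G` with base vertex `x`
and a finite connected graph `H`, the generating function whose `n`-th coefficient
is the number of embeddings of `H` as a complete (induced) subgraph of the ball of
radius `n` is rational. -/
theorem rationality_of_subgraph_counting {V W : Type*} (G : SimpleGraph V) (δ : ℝ)
    (hG : Hyperbolike G δ) (x : V) [Fintype W] (H : SimpleGraph W) (hH : H.Connected) :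
    IsRationalPS (PowerSeries.mk fun n : ℕ =>
      (Nat.card (H ↪g G.induce (ball G x n)) : ℝ)) := by
  classical
  obtain ⟨hc, hv, -, hδ, ht⟩ := hG
  obtain ⟨w₀⟩ := hH.nonempty
  obtain ⟨r, hr⟩ := exists_nat_ge δ
  obtain ⟨R, hR⟩ : ∃ R, R = 2 * r + 2 + Fintype.card W := ⟨_, rfl⟩
  have hfin : ∀ n, {u | G.dist x u = n}.Finite := fun n =>
    (finite_ball hc hv x n).subset fun u hu => le_of_eq hu
  let S : ℕ → Finset V := fun n => (hfin n).toFinset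
  have hS : ∀ n u, u ∈ S n ↔ G.dist x u = n := fun n u => by simp [S]
  have := finite_localTypes hc hv ht x R
  have := Fintype.ofFinite (Quotient (localTypeSetoid hc x R))
  obtain ⟨C, hC⟩ := exists_transfer hc hv hδ hr (R := R) (by omega) (Nat.lt_succ_self _) x S hS
  let T : V → Quotient (localTypeSetoid hc x R) := Quotient.mk _
  have hcount : ∀ y k, rootedCount G H x w₀ y k = rootedCount G H x w₀ (T y).out k := by
    intro y k
    obtain ⟨φ, hφ, h⟩ := Quotient.exact (T y).out_eq
    rw [← rootedCount_eq hc hH (by omega) h, hφ]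
  have hsum : (PowerSeries.mk fun n => (Nat.card (H ↪g G.induce (ball G x n)) : ℝ)) =
      ∑ τ, (PowerSeries.mk fun n => ({y ∈ S n | T y = τ}.card : ℝ)) *
        PowerSeries.mk fun k => (rootedCount G H x w₀ τ.out k : ℝ) := by
    ext n
    simp only [map_sum, PowerSeries.coeff_mul, PowerSeries.coeff_mk]
    rw [Finset.sum_comm, Finset.Nat.sum_antidiagonal_eq_sum_range_succ_mk,
      card_embedding_ball H hc hv x w₀ S hS, Nat.cast_sum]
    refine Finset.sum_congr rfl fun m _ => ?_
    rw [Nat.cast_sum, ← Finset.sum_fiberwise _ T]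
    refine Finset.sum_congr rfl fun τ _ => ?_
    rw [Finset.sum_congr rfl fun y hy => by
      rw [hcount y, (Finset.mem_filter.mp hy).2], Finset.sum_const, nsmul_eq_mul]
  rw [hsum]
  refine IsRationalPS.sum _ fun τ _ => IsRationalPS.mul
    (isRationalPS_of_transfer _ (Nat.succ_pos _) C
      (fun n τ => ({y ∈ S n | T y = τ}.card : ℝ)) hC τ)
    (isRationalPS_of_eventually_const _ R fun k hk => ?_)
  rw [rootedCount_of_le hc hH x _ (by omega) hk]

end CF
end

section
/- Let X be a δ-hyperbolike graph with base vertex x and δ ≥ 1/2, let F : B_{2δ+1}(y) → ℤ be a tournament at a vertex y, and let y′ be a child of y. Then the set { z ∈ B_{2δ+1}(y) : F(z) = 0 and d(z,y′) = 1 } is exactly the set of parents of y′ (vertices z with d(z,y′) = 1 and d(x,y′) = d(x,z) + 1). In particular the number of parents of y′ is determined by F and y′. -/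
open SimpleGraph Filter

namespace CF

/-- Vertices of a walk are at distance at most the difference of their indices. -/
theorem dist_getVert_add_le {V : Type*} {G : SimpleGraph V} (hG : G.Connected) {u v : V}
    (p : G.Walk u v) (i k : ℕ) : G.dist (p.getVert i) (p.getVert (i + k)) ≤ k := by
  induction k with
  | zero => simp
  | succ k ih =>
    have h := hG.dist_triangle (u := p.getVert i) (v := p.getVert (i + k))
      (w := p.getVert (i + (k + 1)))
    have h1 : G.dist (p.getVert (i + k)) (p.getVert (i + (k + 1))) ≤ 1 := by
      by_cases hlt : i + k < p.length
      · exact (SimpleGraph.dist_eq_one_iff_adj.2 (p.adj_getVert_succ hlt)).le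
      · rw [p.getVert_of_length_le (not_lt.1 hlt),
          p.getVert_of_length_le (i := i + (k + 1)) (by omega)]
        simp
    omega

/-- The `i`-th vertex of a geodesic is at distance `i` from its origin. -/
theorem IsGeodesic.dist_getVert {V : Type*} {G : SimpleGraph V} (hG : G.Connected) {u v : V}
    {p : G.Walk u v} (hp : IsGeodesic G p) {i : ℕ} (hi : i ≤ p.length) :
    G.dist u (p.getVert i) = i := by
  have h1 := dist_getVert_add_le hG p 0 i
  have h2 := dist_getVert_add_le hG p i (p.length - i)
  have h3 := hG.dist_triangle (u := u) (v := p.getVert i) (w := v)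
  rw [Nat.add_sub_cancel' hi, p.getVert_length] at h2
  rw [p.getVert_zero, zero_add] at h1
  unfold IsGeodesic at hp
  omega

/-- In a `δ`-hyperbolic graph, two geodesics with common endpoints are `2δ`-close at equal
times. -/
theorem IsDeltaHyperbolic.dist_getVert_le {V : Type*} {G : SimpleGraph V} {δ : ℝ}
    (hG : G.Connected) (hδ : IsDeltaHyperbolic G δ) {u v : V} {p q : G.Walk u v}
    (hp : IsGeodesic G p) (hq : IsGeodesic G q) {t : ℕ} (ht : t ≤ p.length) :
    (G.dist (p.getVert t) (q.getVert t) : ℝ) ≤ 2 * δ := by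
  obtain ⟨w, hw, hd⟩ := (hδ p (Walk.nil : G.Walk v v) q hp (by simp [IsGeodesic]) hq).1
    (p.getVert t) (p.getVert_mem_support t)
  have hwq : w ∈ q.support := by
    rcases hw with hw | hw
    · rw [Walk.support_nil, List.mem_singleton] at hw
      exact hw ▸ q.end_mem_support
    · exact hw
  obtain ⟨s, rfl, hs⟩ := Walk.mem_support_iff_exists_getVert.1 hwq
  have hut := hp.dist_getVert hG ht
  have hus := hq.dist_getVert hG hs
  have h1 := hG.dist_triangle (u := u) (v := p.getVert t) (w := q.getVert s)
  have h2 := hG.dist_triangle (u := u) (v := q.getVert s) (w := p.getVert t)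
  rw [SimpleGraph.dist_comm (u := q.getVert s)] at h2
  have h3 := hG.dist_triangle (u := p.getVert t) (v := q.getVert s) (w := q.getVert t)
  have h4 : G.dist (q.getVert s) (q.getVert t) ≤ G.dist (p.getVert t) (q.getVert s) := by
    rcases le_total s t with hst | hst
    · have h := dist_getVert_add_le hG q s (t - s)
      rw [Nat.add_sub_cancel' hst] at h
      omega
    · have h := dist_getVert_add_le hG q t (s - t)
      rw [Nat.add_sub_cancel' hst, SimpleGraph.dist_comm] at h
      omega
  have h5 : (G.dist (p.getVert t) (q.getVert t) : ℝ) ≤ 2 * G.dist (p.getVert t) (q.getVert s) := by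
    exact_mod_cast (by omega : G.dist (p.getVert t) (q.getVert t) ≤
      2 * G.dist (p.getVert t) (q.getVert s))
  linarith

/-- Extending a geodesic by an edge that increases the distance gives a geodesic with the same
initial vertices. -/
theorem IsGeodesic.concat {V : Type*} {G : SimpleGraph V} {u v w : V} {p : G.Walk u v}
    (hp : IsGeodesic G p) (h : G.Adj v w) (hd : G.dist u w = G.dist u v + 1) :
    IsGeodesic G (p.concat h) := by
  rw [IsGeodesic, Walk.length_concat, hd, hp]

theorem getVert_concat_of_le {V : Type*} {G : SimpleGraph V} {u v w : V} (p : G.Walk u v)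
    (h : G.Adj v w) {i : ℕ} (hi : i ≤ p.length) : (p.concat h).getVert i = p.getVert i := by
  rw [Walk.concat_eq_append, Walk.getVert_append]
  split_ifs with hlt
  · rfl
  · obtain rfl : i = p.length := by omega
    simp

/-- Two parents of the same vertex are competitors of each other. -/
theorem competitor_of_common_child {V : Type*} {G : SimpleGraph V} {δ : ℝ}
    (hδ : (1 : ℝ) / 2 ≤ δ) (hG : G.Connected) (hyp : IsDeltaHyperbolic G δ) {x y z w : V}
    (hy : G.dist y w = 1) (hxy : G.dist x w = G.dist x y + 1)
    (hz : G.dist z w = 1) (hxz : G.dist x w = G.dist x z + 1) : Competitor G δ x y z := by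
  have hyz : G.dist y z ≤ 2 := by
    have h := hG.dist_triangle (u := y) (v := w) (w := z)
    rw [SimpleGraph.dist_comm (u := w)] at h
    omega
  have hyz' : (G.dist y z : ℝ) ≤ 2 := by exact_mod_cast hyz
  obtain ⟨p, hp⟩ := hG.exists_walk_length_eq_dist x z
  refine ⟨by linarith, by omega, p, hp, fun q hq i hi => ?_⟩
  have hpq : p.length = q.length := by
    unfold IsGeodesic at hq
    omega
  have hay := SimpleGraph.dist_eq_one_iff_adj.1 hy
  have haz := SimpleGraph.dist_eq_one_iff_adj.1 hz
  have h := hyp.dist_getVert_le hG (IsGeodesic.concat hp haz hxz) (hq.concat hay hxy)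
    (t := p.length - i) (by rw [Walk.length_concat]; omega)
  rw [getVert_concat_of_le p haz (by omega), getVert_concat_of_le q hay (by omega)] at h
  rw [← hpq]
  linarith

/-- for a tournament `F` at `y` and a child `y'` of `y` (with
`δ ≥ 1/2`), the set `{ z ∈ B_{2δ+1}(y) : F(z) = 0, d(z,y') = 1 }` is exactly the
set of parents of `y'`. -/
theorem parents_determined_by_tournament {V : Type*} (G : SimpleGraph V) (δ : ℝ)
    (hδ : (1:ℝ)/2 ≤ δ) (hG : Hyperbolike G δ) (x y y' : V) (F : V → ℤ)
    (hF : Tournament G δ x y F)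
    (hchild : G.dist y y' = 1 ∧ G.dist x y' = G.dist x y + 1) :
    {z : V | (G.dist y z : ℝ) ≤ 2*δ+1 ∧ F z = 0 ∧ G.dist z y' = 1} =
    {z : V | G.dist z y' = 1 ∧ G.dist x y' = G.dist x z + 1} := by
  obtain ⟨hconn, -, -, hyp, -⟩ := hG
  obtain ⟨hy, hxy⟩ := hchild
  ext z
  simp only [Set.mem_ofPred_eq]
  constructor
  · rintro ⟨hyz, hFz, hz⟩
    have h1 := (hF.1 z hyz).1
    have h2 := hconn.dist_triangle (u := x) (v := z) (w := y')
    exact ⟨hz, by omega⟩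
  · rintro ⟨hz, hxz⟩
    have hc := competitor_of_common_child hδ hconn hyp hy hxy hz hxz
    have h := hF.2 z hc
    exact ⟨hc.1, by omega, hz⟩

end CF
end

section
/- Let X be a δ-hyperbolike graph with base vertex x which is nonelementary (X is infinite and not quasi-isometric to a point or a line). Then there are constants λ > 1, C > 1 and an integer k ≥ 0 such that C⁻¹ λⁿ nᵏ ≤ |X_n| ≤ C λⁿ nᵏ for all n ≥ 1, where |X_n| is the number of vertices at distance at most n from x. -/
open SimpleGraph Filter

namespace CF

section Geodesics

variable {V : Type*} {G : SimpleGraph V}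

lemma IsGeodesic.dist_getVert_left (hc : G.Connected) {u v : V} {p : G.Walk u v}
    (hp : IsGeodesic G p) {i : ℕ} (hi : i ≤ p.length) : G.dist u (p.getVert i) = i := by
  have h₁ := dist_le (p.take i)
  have h₂ := dist_le (p.drop i)
  have h₃ := hc.dist_triangle (u := u) (v := p.getVert i) (w := v)
  rw [Walk.take_length] at h₁
  rw [Walk.drop_length] at h₂
  unfold IsGeodesic at hp
  omega

lemma IsGeodesic.dist_getVert_right (hc : G.Connected) {u v : V} {p : G.Walk u v}
    (hp : IsGeodesic G p) {i : ℕ} (hi : i ≤ p.length) :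
    G.dist (p.getVert i) v = p.length - i := by
  have h₁ := hp.dist_getVert_left hc hi
  have h₂ := dist_le (p.drop i)
  have h₃ := hc.dist_triangle (u := u) (v := p.getVert i) (w := v)
  rw [Walk.drop_length] at h₂
  unfold IsGeodesic at hp
  omega

lemma IsGeodesic.dist_getVert_getVert (hc : G.Connected) {u v : V} {p : G.Walk u v}
    (hp : IsGeodesic G p) {i j : ℕ} (hij : i ≤ j) (hj : j ≤ p.length) :
    G.dist (p.getVert i) (p.getVert j) = j - i := by
  refine le_antisymm ?_ ?_
  · have := dist_le ((p.drop i).take (j - i))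
    rw [Walk.take_length, Walk.drop_getVert, Nat.add_sub_cancel' hij] at this
    omega
  · have h₁ := hp.dist_getVert_left hc (hij.trans hj)
    have h₂ := hp.dist_getVert_left hc hj
    have h₃ := hc.dist_triangle (u := u) (v := p.getVert i) (w := p.getVert j)
    omega

lemma IsGeodesic.dist_add_dist (hc : G.Connected) {u v w : V} {p : G.Walk u v}
    (hp : IsGeodesic G p) (hw : w ∈ p.support) : G.dist u w + G.dist w v = G.dist u v := by
  obtain ⟨i, rfl, hi⟩ := Walk.mem_support_iff_exists_getVert.1 hw
  rw [hp.dist_getVert_left hc hi, hp.dist_getVert_right hc hi, ← hp]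
  omega

lemma exists_geodesic (hc : G.Connected) (u v : V) : ∃ p : G.Walk u v, IsGeodesic G p :=
  hc.exists_walk_length_eq_dist u v

lemma exists_dist_eq_dist_eq_sub (hc : G.Connected) (u v : V) {i : ℕ} (hi : i ≤ G.dist u v) :
    ∃ w, G.dist u w = i ∧ G.dist w v = G.dist u v - i := by
  obtain ⟨p, hp⟩ := exists_geodesic hc u v
  have hi' : i ≤ p.length := by rwa [hp]
  exact ⟨p.getVert i, hp.dist_getVert_left hc hi', by rw [hp.dist_getVert_right hc hi', hp]⟩

lemma dist_iso_le (hc : G.Connected) (φ : G ≃g G) (u v : V) :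
    G.dist (φ u) (φ v) ≤ G.dist u v := by
  obtain ⟨p, hp⟩ := exists_geodesic hc u v
  have := dist_le (p.map φ.toHom)
  rw [Walk.length_map, hp] at this
  exact this

end Geodesics

section FourPoint

variable {V : Type*} {G : SimpleGraph V}

/-- The four-point condition of Gromov, in additive form, with constant `K`. -/
def FourPoint (G : SimpleGraph V) (K : ℕ) : Prop :=
  ∀ a b c e : V, G.dist a c + G.dist b e ≤
    max (G.dist a b + G.dist c e) (G.dist a e + G.dist b c) + K

/-- Every geodesic side of a thin triangle has a vertex which is almost on both other sides. -/
lemma IsDeltaHyperbolic.exists_center (hc : G.Connected) {δ : ℝ} {N : ℕ} (hN : δ ≤ N)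
    (hG : IsDeltaHyperbolic G δ) {a c : V} {r : G.Walk a c} (hr : IsGeodesic G r) (b : V) :
    ∃ i ≤ r.length,
      G.dist a (r.getVert i) + G.dist (r.getVert i) b ≤ G.dist a b + 2 * (N + 1) ∧
      G.dist b (r.getVert i) + G.dist (r.getVert i) c ≤ G.dist b c + 2 * (N + 1) := by
  obtain ⟨p, hp⟩ := exists_geodesic hc a b
  obtain ⟨q, hq⟩ := exists_geodesic hc b c
  have near : ∀ {u v : V} {s : G.Walk u v}, IsGeodesic G s → ∀ m w : V, w ∈ s.support →
      G.dist m w ≤ N + 1 → G.dist u m + G.dist m v ≤ G.dist u v + 2 * (N + 1) := by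
    intro u v s hs m w hw hm
    have h₁ := hs.dist_add_dist hc hw
    have h₂ := hc.dist_triangle (u := u) (v := w) (w := m)
    have h₃ := hc.dist_triangle (u := m) (v := w) (w := v)
    rw [G.dist_comm (u := w) (v := m)] at h₂
    omega
  have close : ∀ i, (∃ w ∈ p.support, G.dist (r.getVert i) w ≤ N) ∨
      (∃ w ∈ q.support, G.dist (r.getVert i) w ≤ N) := by
    intro i
    obtain ⟨w, hw, hd⟩ := (hG p q r hp hq hr).2.2 _ (r.getVert_mem_support i)
    have hd' : G.dist (r.getVert i) w ≤ N := by exact_mod_cast hd.trans hN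
    exact hw.imp (fun h => ⟨w, h, hd'⟩) (fun h => ⟨w, h, hd'⟩)
  suffices ∃ i ≤ r.length, (∃ w ∈ p.support, G.dist (r.getVert i) w ≤ N + 1) ∧
      (∃ w ∈ q.support, G.dist (r.getVert i) w ≤ N + 1) by
    obtain ⟨i, hi, ⟨w, hw, hd⟩, ⟨w', hw', hd'⟩⟩ := this
    exact ⟨i, hi, near hp _ w hw hd, near hq _ w' hw' hd'⟩
  by_contra! hcon
  have all : ∀ i ≤ r.length, ∃ w ∈ p.support, G.dist (r.getVert i) w ≤ N := by
    intro i
    induction i with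
    | zero => exact fun _ => ⟨a, p.start_mem_support, by simp⟩
    | succ i ih =>
      intro hi
      obtain ⟨w, hw, hd⟩ := ih (by omega)
      refine (close (i + 1)).resolve_right ?_
      rintro ⟨w', hw', hd'⟩
      have h₁ := hcon i (by omega) ⟨w, hw, by omega⟩ w' hw'
      have h₂ := hc.dist_triangle (u := r.getVert i) (v := r.getVert (i + 1)) (w := w')
      have h₃ := dist_eq_one_iff_adj.2 (r.adj_getVert_succ (i := i) (by omega))
      omega
  obtain ⟨w, hw, hd⟩ := all r.length le_rfl
  have := hcon r.length le_rfl ⟨w, hw, by omega⟩ c q.end_mem_support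
  simp at this

lemma IsDeltaHyperbolic.fourPoint (hc : G.Connected) {δ : ℝ} (hG : IsDeltaHyperbolic G δ) :
    ∃ K, FourPoint G K := by
  obtain ⟨N, hN⟩ := exists_nat_ge δ
  refine ⟨4 * (N + 1), fun a b c e => ?_⟩
  obtain ⟨r, hr⟩ := exists_geodesic hc a c
  obtain ⟨i, hi, hab, hbc⟩ := hG.exists_center hc hN hr b
  obtain ⟨j, hj, hae, hec⟩ := hG.exists_center hc hN hr e
  have hi₁ := hr.dist_getVert_left hc hi
  have hi₂ := hr.dist_getVert_right hc hi
  have hj₁ := hr.dist_getVert_left hc hj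
  have hj₂ := hr.dist_getVert_right hc hj
  have hlen : r.length = G.dist a c := hr
  have tri := fun u v w => hc.dist_triangle (u := u) (v := v) (w := w)
  have comm := fun u v => G.dist_comm (u := u) (v := v)
  rcases le_total i j with h | h
  · have h₁ := hr.dist_getVert_getVert hc h hj
    have h₂ := tri b (r.getVert i) e
    have h₃ := tri (r.getVert i) (r.getVert j) e
    omega
  · have h₁ := hr.dist_getVert_getVert hc h hi
    have h₂ := tri b (r.getVert i) e
    have h₃ := tri (r.getVert i) (r.getVert j) e
    have h₄ := comm (r.getVert i) (r.getVert j)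
    have h₅ := comm b (r.getVert i)
    have h₆ := comm e (r.getVert j)
    have h₇ := comm c e
    omega

end FourPoint

section Balls

variable {V : Type*} {G : SimpleGraph V}

lemma ball_finite (hc : G.Connected) (hv : UnifFiniteValence G) (x : V) (n : ℕ) :
    (ball G x n).Finite := by
  obtain ⟨D, hD⟩ := hv
  induction n with
  | zero =>
    refine (Set.finite_singleton x).subset fun y hy => ?_
    have : G.dist x y = 0 := Nat.le_zero.1 hy
    exact (hc.dist_eq_zero_iff.1 this).symm
  | succ n ih =>
    refine (ih.union (ih.biUnion fun y _ => (hD y).1)).subset fun z hz => ?_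
    rcases Nat.lt_or_ge n (G.dist x z) with h | h
    · obtain ⟨y, hy, hyz⟩ := exists_dist_eq_dist_eq_sub hc x z h.le
      have hz' : G.dist x z ≤ n + 1 := hz
      refine Or.inr (Set.mem_biUnion (x := y) hy.le ?_)
      exact dist_eq_one_iff_adj.1 (by omega)
    · exact Or.inl h

lemma ncard_ball_le_of_iso (hc : G.Connected) (hv : UnifFiniteValence G) (φ : G ≃g G) (x : V)
    (n : ℕ) : (ball G x n).ncard ≤ (ball G (φ x) n).ncard := by
  refine Set.ncard_le_ncard_of_injOn φ (fun y hy => ?_) φ.injective.injOn (ball_finite hc hv _ n)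
  change G.dist (φ x) (φ y) ≤ n
  rwa [dist_iso hc]

lemma ncard_ball_eq (hc : G.Connected) (hv : UnifFiniteValence G) (ht : VertexTransitive G)
    (x y : V) (n : ℕ) : (ball G x n).ncard = (ball G y n).ncard := by
  have key : ∀ u v : V, (ball G u n).ncard ≤ (ball G v n).ncard := by
    intro u v
    obtain ⟨φ, rfl⟩ := ht u v
    exact ncard_ball_le_of_iso hc hv φ u n
  exact le_antisymm (key x y) (key y x)

lemma ncard_ball_pos (hc : G.Connected) (hv : UnifFiniteValence G) (x : V) (n : ℕ) :
    0 < (ball G x n).ncard :=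
  (Set.ncard_pos (ball_finite hc hv x n)).2 ⟨x, by simp [ball]⟩

lemma ncard_ball_add_le (hc : G.Connected) (hv : UnifFiniteValence G) (ht : VertexTransitive G)
    (x : V) (n m : ℕ) :
    (ball G x (n + m)).ncard ≤ (ball G x n).ncard * (ball G x m).ncard := by
  classical
  let B : V → ℕ → Finset V := fun y k => (ball_finite hc hv y k).toFinset
  have hB : ∀ y k, (B y k).card = (ball G x k).ncard := fun y k => by
    rw [ncard_ball_eq hc hv ht x y, Set.ncard_eq_toFinset_card _ (ball_finite hc hv y k)]
  have mem : ∀ y k z, z ∈ B y k ↔ G.dist y z ≤ k := fun y k z => by simp [B, ball]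
  have hsub : B x (n + m) ⊆ (B x n).biUnion fun y => B y m := by
    intro z hz
    rw [mem] at hz
    obtain ⟨y, hy, hyz⟩ := exists_dist_eq_dist_eq_sub hc x z (min_le_right n (G.dist x z))
    exact Finset.mem_biUnion.2 ⟨y, (mem _ _ _).2 (by omega), (mem _ _ _).2 (by omega)⟩
  calc (ball G x (n + m)).ncard = (B x (n + m)).card := (hB _ _).symm
    _ ≤ _ := Finset.card_le_card hsub
    _ ≤ (B x n).card * (ball G x m).ncard :=
        Finset.card_biUnion_le_card_mul _ _ _ fun y _ => (hB y m).le
    _ = _ := by rw [hB]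

/-- Concatenations of two segments are counted by the length of the result: if the endpoint is at
distance `r`, the intermediate point is determined up to the size of a ball whose radius is about
half of the lost length. -/
lemma FourPoint.ncard_ball_mul_le {K : ℕ} (hK : FourPoint G K) (hc : G.Connected)
    (hv : UnifFiniteValence G) (ht : VertexTransitive G) (x : V) (n m : ℕ) :
    (ball G x n).ncard * (ball G x m).ncard ≤ ∑ r ∈ Finset.range (n + m + 1),
      (ball G x r).ncard * (ball G x ((n + m - r) / 2 + (K + 1))).ncard := by
  classical
  let B : V → ℕ → Finset V := fun y k => (ball_finite hc hv y k).toFinset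
  have hB : ∀ y k, (B y k).card = (ball G x k).ncard := fun y k => by
    rw [ncard_ball_eq hc hv ht x y, Set.ncard_eq_toFinset_card _ (ball_finite hc hv y k)]
  have mem : ∀ y k z, z ∈ B y k ↔ G.dist y z ≤ k := fun y k z => by simp [B, ball]
  choose w hxw hwz using fun z => exists_dist_eq_dist_eq_sub hc x z
    (min_le_left (G.dist x z) ((n + G.dist x z - m) / 2))
  let P : Finset (Σ _ : V, V) := (B x n).sigma fun y => B y m
  let Q : ℕ → Finset (Σ _ : V, V) := fun r =>
    (B x r).sigma fun z => B (w z) ((n + m - r) / 2 + (K + 1))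
  have hP : P.card = (ball G x n).ncard * (ball G x m).ncard := by
    simp [P, Finset.card_sigma, hB]
  have hQ : ∀ r, (Q r).card =
      (ball G x r).ncard * (ball G x ((n + m - r) / 2 + (K + 1))).ncard := fun r => by
    simp [Q, Finset.card_sigma, hB]
  have hle : P.card ≤ ((Finset.range (n + m + 1)).biUnion Q).card := by
    refine Finset.card_le_card_of_injOn (fun q => ⟨q.2, q.1⟩) ?_ ?_
    · rintro ⟨y, z⟩ hyz
      obtain ⟨hy, hz⟩ := Finset.mem_sigma.1 (Finset.mem_coe.1 hyz)
      rw [mem] at hy hz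
      simp only at hy hz
      have h₁ := hc.dist_triangle (u := x) (v := y) (w := z)
      refine Finset.mem_coe.2 (Finset.mem_biUnion.2 ⟨G.dist x z, Finset.mem_range.2 (by omega),
        Finset.mem_sigma.2 ⟨(mem _ _ _).2 le_rfl, (mem _ _ _).2 ?_⟩⟩)
      simp only
      have h₂ := hK x y z (w z)
      have h₃ := hxw z
      have h₄ := hwz z
      rw [G.dist_comm (u := y) (v := w z), G.dist_comm (u := z) (v := w z)] at h₂
      have h₅ := hc.dist_triangle (u := x) (v := z) (w := y)
      have h₆ := hc.dist_triangle (u := y) (v := x) (w := z)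
      rw [G.dist_comm (u := z) (v := y)] at h₅
      rw [G.dist_comm (u := y) (v := x)] at h₆
      omega
    · rintro ⟨y, z⟩ _ ⟨y', z'⟩ _ h
      simp only [Sigma.mk.injEq, heq_eq_eq] at h ⊢
      exact h.symm
  calc _ = P.card := hP.symm
    _ ≤ _ := hle
    _ ≤ ∑ r ∈ Finset.range (n + m + 1), (Q r).card := Finset.card_biUnion_le
    _ = _ := Finset.sum_congr rfl fun r _ => hQ r

end Balls

section Sequences

variable {b : ℕ → ℝ}

/-- A submultiplicative sequence which is exponentially large along a subsequence has an
exponential growth rate greater than one, which bounds it from below. -/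
lemma exists_growth_rate (h1 : ∀ n, 1 ≤ b n) (hmul : ∀ n m, b (n + m) ≤ b n * b m) {R : ℕ}
    (hR : 0 < R) (hexp : ∀ k : ℕ, 2 ^ k ≤ b (k * R)) :
    ∃ lam : ℝ, 1 < lam ∧ (∀ n, lam ^ n ≤ b n) ∧
      ∀ μ, lam < μ → ∃ C, 0 < C ∧ ∀ n, b n ≤ C * μ ^ n := by
  have hpos : ∀ n, 0 < b n := fun n => zero_lt_one.trans_le (h1 n)
  have hsub : Subadditive fun n => Real.log (b n) := fun n m => by
    rw [← Real.log_mul (hpos n).ne' (hpos m).ne']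
    exact Real.log_le_log (hpos _) (hmul n m)
  have hbdd : BddBelow (Set.range fun n : ℕ => Real.log (b n) / n) := by
    refine ⟨0, ?_⟩
    rintro _ ⟨n, rfl⟩
    exact div_nonneg (Real.log_nonneg (h1 n)) n.cast_nonneg
  have hlim := hsub.tendsto_lim hbdd
  have hR' : (0 : ℝ) < R := by exact_mod_cast hR
  have hL : Real.log 2 / R ≤ hsub.lim := by
    have ht : Tendsto (fun k : ℕ => (k + 1) * R) atTop atTop :=
      tendsto_atTop_mono (fun k => (Nat.le_succ k).trans (Nat.le_mul_of_pos_right _ hR)) tendsto_id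
    refine ge_of_tendsto' (hlim.comp ht) fun k => ?_
    have h := Real.log_le_log (by positivity) (hexp (k + 1))
    rw [Real.log_pow] at h
    have hk : (0 : ℝ) < ((k + 1 : ℕ) : ℝ) := by positivity
    simp only [Function.comp_apply]
    rw [div_le_div_iff₀ hR' (by positivity)]
    push_cast at h hk ⊢
    nlinarith
  have hL0 : 0 < hsub.lim := lt_of_lt_of_le (div_pos (Real.log_pos one_lt_two) hR') hL
  have hlam : 1 < Real.exp hsub.lim := Real.one_lt_exp_iff.2 hL0
  refine ⟨Real.exp hsub.lim, hlam, fun n => ?_, fun μ hμ => ?_⟩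
  · rcases Nat.eq_zero_or_pos n with rfl | hn
    · simpa using h1 0
    · have h := hsub.lim_le_div hbdd hn.ne'
      have hn' : (0 : ℝ) < n := by exact_mod_cast hn
      rw [le_div_iff₀ hn'] at h
      rw [← Real.exp_nat_mul, ← Real.le_log_iff_exp_le (hpos n)]
      linarith
  · have hμ0 : 0 < μ := (Real.exp_pos _).trans hμ
    have hμ1 : 1 ≤ μ := (hlam.trans hμ).le
    have hlog : hsub.lim < Real.log μ := (Real.lt_log_iff_exp_lt hμ0).2 hμ
    obtain ⟨N, hN⟩ := eventually_atTop.1 (hlim.eventually_lt_const hlog)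
    have hsum : 0 ≤ ∑ i ∈ Finset.range (N + 1), b i := Finset.sum_nonneg fun i _ => (hpos i).le
    refine ⟨1 + ∑ i ∈ Finset.range (N + 1), b i, by linarith, fun n => ?_⟩
    have hμn : 1 ≤ μ ^ n := one_le_pow₀ hμ1
    rcases Nat.lt_or_ge n (N + 1) with h | h
    · have := Finset.single_le_sum (f := b) (fun i _ => (hpos i).le) (Finset.mem_range.2 h)
      nlinarith
    · have hn' : (0 : ℝ) < n := by exact_mod_cast (by omega : 0 < n)
      have hlt := hN n (by omega)
      rw [div_lt_iff₀ hn', mul_comm, ← Real.log_pow] at hlt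
      have := (Real.log_lt_log_iff (hpos n) (by positivity)).1 hlt
      nlinarith

/-- If the products `b n * b m` are controlled by the maximum of `b k / lam ^ k` over `k ≤ n + m`,
then a subexponential bound on `b k / lam ^ k` improves to a constant bound. -/
lemma le_mul_pow_of_mul_le {lam A : ℝ} (hlam : 0 < lam) (hA : 0 < A)
    (hupper : ∀ μ, lam < μ → ∃ C, 0 < C ∧ ∀ n, b n ≤ C * μ ^ n)
    (hmul : ∀ (n : ℕ) (M : ℝ), 0 < M → (∀ k ≤ n + n, b k ≤ M * lam ^ k) →
      b n * b n ≤ A * M * lam ^ (n + n)) (n : ℕ) :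
    b n ≤ 2 * A * lam ^ n := by
  by_contra! hn
  have key : ∀ k : ℕ, ∃ q ≤ 2 ^ k * n, A * 2 ^ 2 ^ k * lam ^ q < b q := by
    intro k
    induction k with
    | zero => exact ⟨n, by simp, by simpa [mul_comm A 2] using hn⟩
    | succ k ih =>
      obtain ⟨q, hq, hbq⟩ := ih
      by_contra! hcon
      have h := hmul q (A * 2 ^ 2 ^ (k + 1)) (by positivity)
        fun j hj => hcon j (by rw [pow_succ]; linarith)
      have h' := mul_lt_mul'' hbq hbq (by positivity) (by positivity)
      refine absurd (h'.trans_le h) (not_lt.2 (le_of_eq ?_))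
      rw [pow_add lam, pow_succ 2 k, pow_mul]
      ring
  obtain ⟨ρ, hρ1, hρ⟩ : ∃ ρ : ℝ, 1 < ρ ∧ ρ ^ n ≤ 3 / 2 := by
    refine ⟨(3 / 2 : ℝ) ^ ((n + 1 : ℕ) : ℝ)⁻¹,
      Real.one_lt_rpow (by norm_num) (by positivity), ?_⟩
    have h := Real.rpow_inv_natCast_pow (x := 3 / 2) (by norm_num) n.succ_ne_zero
    have h1 : 1 ≤ (3 / 2 : ℝ) ^ ((n + 1 : ℕ) : ℝ)⁻¹ :=
      Real.one_le_rpow (by norm_num) (by positivity)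
    exact (pow_le_pow_right₀ h1 n.le_succ).trans h.le
  obtain ⟨C, hC, hbC⟩ := hupper (lam * ρ) (by nlinarith)
  obtain ⟨k, hk⟩ := pow_unbounded_of_one_lt (C / A) (by norm_num : (1 : ℝ) < 4 / 3)
  obtain ⟨q, hq, hbq⟩ := key k
  have h₁ : b q ≤ C * (3 / 2) ^ 2 ^ k * lam ^ q := by
    calc b q ≤ C * (lam * ρ) ^ q := hbC q
      _ = C * ρ ^ q * lam ^ q := by rw [mul_pow]; ring
      _ ≤ C * (3 / 2) ^ 2 ^ k * lam ^ q := by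
        gcongr
        calc ρ ^ q ≤ ρ ^ (n * 2 ^ k) := pow_le_pow_right₀ hρ1.le (by linarith)
          _ = (ρ ^ n) ^ 2 ^ k := pow_mul _ _ _
          _ ≤ (3 / 2) ^ 2 ^ k := by gcongr
  have h₂ : A * 2 ^ 2 ^ k < C * (3 / 2) ^ 2 ^ k :=
    lt_of_mul_lt_mul_right (hbq.trans_le h₁) (by positivity)
  have h₃ : C / A < (4 / 3 : ℝ) ^ 2 ^ k :=
    hk.trans_le (pow_le_pow_right₀ (by norm_num) Nat.lt_two_pow_self.le)
  rw [div_lt_iff₀ hA] at h₃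
  have h₄ : (2 : ℝ) ^ 2 ^ k = (4 / 3) ^ 2 ^ k * (3 / 2) ^ 2 ^ k := by
    rw [← mul_pow]; norm_num
  have h₅ : (0 : ℝ) < (3 / 2) ^ 2 ^ k := by positivity
  rw [h₄] at h₂
  nlinarith

/-- Pure exponential growth from submultiplicativity, exponential growth, and a convolution
inequality in which the second factor grows at most like the square root of the first. -/
lemma exists_pure_exponential_growth (h1 : ∀ n, 1 ≤ b n) (hmul : ∀ n m, b (n + m) ≤ b n * b m)
    {R : ℕ} (hR : 0 < R) (hexp : ∀ k : ℕ, 2 ^ k ≤ b (k * R)) (K : ℕ)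
    (hconv : ∀ n m, b n * b m ≤ ∑ r ∈ Finset.range (n + m + 1), b r * b ((n + m - r) / 2 + K)) :
    ∃ lam C : ℝ, 1 < lam ∧ 1 < C ∧ ∀ n, lam ^ n ≤ b n ∧ b n ≤ C * lam ^ n := by
  obtain ⟨lam, hlam, hlower, hupper⟩ := exists_growth_rate h1 hmul hR hexp
  have hlam0 : 0 < lam := zero_lt_one.trans hlam
  have hpos : ∀ n, 0 ≤ b n := fun n => zero_le_one.trans (h1 n)
  obtain ⟨ν, hν, hνlam⟩ : ∃ ν, Real.sqrt lam < ν ∧ ν < lam :=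
    exists_between ((Real.sqrt_lt' hlam0).2 (by nlinarith))
  have hν1 : 1 ≤ ν := (Real.one_le_sqrt.2 hlam.le).trans hν.le
  have hν0 : 0 < ν := zero_lt_one.trans_le hν1
  obtain ⟨C, hC, hbC⟩ := hupper (ν ^ 2) ((Real.sqrt_lt' hν0).1 hν)
  have hhalf : ∀ s, b (s / 2 + K) ≤ C * (ν ^ 2) ^ K * ν ^ s := fun s => by
    calc b (s / 2 + K) ≤ C * (ν ^ 2) ^ (s / 2 + K) := hbC _
      _ = C * (ν ^ 2) ^ K * ν ^ (2 * (s / 2)) := by rw [pow_add, pow_mul]; ring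
      _ ≤ C * (ν ^ 2) ^ K * ν ^ s := by
        gcongr
        exact Nat.mul_div_le s 2
  set D := C * (ν ^ 2) ^ K with hD
  have hD0 : 0 < D := by positivity
  have hq0 : 0 ≤ ν / lam := by positivity
  have hq1 : ν / lam < 1 := (div_lt_one hlam0).2 hνlam
  set A := D * (1 - ν / lam)⁻¹ with hA
  have hA0 : 0 < A := mul_pos hD0 (inv_pos.2 (by linarith))
  have hbound : ∀ n, b n ≤ 2 * A * lam ^ n := by
    refine le_mul_pow_of_mul_le hlam0 hA0 hupper fun n M hM hle => ?_
    calc b n * b n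
        ≤ ∑ r ∈ Finset.range (n + n + 1), b r * b ((n + n - r) / 2 + K) := hconv n n
      _ ≤ ∑ r ∈ Finset.range (n + n + 1),
            D * M * lam ^ (n + n) * (ν / lam) ^ (n + n + 1 - 1 - r) := by
          refine Finset.sum_le_sum fun r hr => ?_
          have hr' : r ≤ n + n := Nat.lt_succ_iff.1 (Finset.mem_range.1 hr)
          calc b r * b ((n + n - r) / 2 + K)
              ≤ (M * lam ^ r) * (D * ν ^ (n + n - r)) :=
                mul_le_mul (hle r hr') (hhalf _) (hpos _) (by positivity)
            _ = _ := by
                have hsplit : lam ^ (n + n) = lam ^ r * lam ^ (n + n - r) := by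
                  rw [← pow_add, Nat.add_sub_cancel' hr']
                rw [Nat.add_sub_cancel, div_pow, hsplit]
                field_simp
      _ = D * M * lam ^ (n + n) * ∑ r ∈ Finset.range (n + n + 1), (ν / lam) ^ r := by
          rw [← Finset.mul_sum, Finset.sum_range_reflect (fun r => (ν / lam) ^ r)]
      _ ≤ D * M * lam ^ (n + n) * (1 - ν / lam)⁻¹ := by
          gcongr
          rw [← tsum_geometric_of_lt_one hq0 hq1]
          exact (summable_geometric_of_lt_one hq0 hq1).sum_le_tsum _ fun _ _ => by positivity
      _ = A * M * lam ^ (n + n) := by rw [hA]; ring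
  refine ⟨lam, 2 * A + 1, hlam, by linarith, fun n => ⟨hlower n, (hbound n).trans ?_⟩⟩
  gcongr
  linarith

end Sequences

section Tripods

variable {V : Type*} {G : SimpleGraph V}

/-- Three points at distance `R` from `w` whose pairwise distances are at least `2 * R - C`. -/
def IsTripod (G : SimpleGraph V) (R C : ℕ) (w : V) (t : Fin 3 → V) : Prop :=
  (∀ i, G.dist w (t i) = R) ∧ ∀ i j, i ≠ j → 2 * R ≤ G.dist (t i) (t j) + C

lemma IsTripod.map (hc : G.Connected) {R C : ℕ} {w : V} {t : Fin 3 → V} (h : IsTripod G R C w t)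
    (φ : G ≃g G) : IsTripod G R C (φ w) (φ ∘ t) :=
  ⟨fun i => by simp [dist_iso hc, h.1 i], fun i j hij => by simpa [dist_iso hc] using h.2 i j hij⟩

/-- From any incoming direction, at least two legs of a tripod do not backtrack. -/
lemma FourPoint.exists_two_legs {K : ℕ} (hK : FourPoint G K) {R C : ℕ} {w : V} {t : Fin 3 → V}
    (h : IsTripod G R C w t) (p : V) :
    ∃ i j, i ≠ j ∧ G.dist p w + R ≤ G.dist p (t i) + (C + K) ∧
      G.dist p w + R ≤ G.dist p (t j) + (C + K) := by
  have key : ∀ i j, i ≠ j → G.dist p w + R ≤ G.dist p (t i) + (C + K) ∨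
      G.dist p w + R ≤ G.dist p (t j) + (C + K) := by
    intro i j hij
    have h₁ := hK (t i) p (t j) w
    have h₂ := h.1 i
    have h₃ := h.1 j
    have h₄ := h.2 i j hij
    rw [G.dist_comm (u := t i) (v := p), G.dist_comm (u := t j) (v := w),
      G.dist_comm (u := t i) (v := w)] at h₁
    omega
  have h01 := key 0 1 (by decide)
  have h02 := key 0 2 (by decide)
  have h12 := key 1 2 (by decide)
  by_cases h0 : G.dist p w + R ≤ G.dist p (t 0) + (C + K)
  · rcases h12 with h | h
    · exact ⟨0, 1, by decide, h0, h⟩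
    · exact ⟨0, 2, by decide, h0, h⟩
  · exact ⟨1, 2, by decide, h01.resolve_left h0, h02.resolve_left h0⟩

/-- Long tripods at every vertex produce a binary tree of almost non-backtracking paths. -/
lemma FourPoint.exists_finset_two_pow {K : ℕ} (hK : FourPoint G K) (hc : G.Connected) {R C : ℕ}
    (hR : C + 2 * K < R) (htri : ∀ w, ∃ t, IsTripod G R C w t) (k : ℕ) :
    ∀ p w : V, ∃ s : Finset V, s.card = 2 ^ k ∧ ∀ v ∈ s, G.dist w v ≤ k * R ∧
      G.dist p w + G.dist w v ≤ G.dist p v + (C + 2 * K) := by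
  classical
  induction k with
  | zero => exact fun p w => ⟨{w}, by simp, by simp⟩
  | succ k ih =>
    intro p w
    obtain ⟨t, ht⟩ := htri w
    obtain ⟨i, j, hij, hi, hj⟩ := hK.exists_two_legs ht p
    obtain ⟨s, hs, hsv⟩ := ih w (t i)
    obtain ⟨s', hs', hsv'⟩ := ih w (t j)
    have htij := ht.2 i j hij
    have leg : ∀ l v, G.dist p w + R ≤ G.dist p (t l) + (C + K) → G.dist (t l) v ≤ k * R →
        G.dist w (t l) + G.dist (t l) v ≤ G.dist w v + (C + 2 * K) →
        G.dist w v ≤ (k + 1) * R ∧ G.dist p w + G.dist w v ≤ G.dist p v + (C + 2 * K) := by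
      intro l v h₁ h₂ h₃
      have h₄ := ht.1 l
      have h₅ := hc.dist_triangle (u := w) (v := t l) (w := v)
      have h₆ := hK p v (t l) w
      rw [G.dist_comm (u := v) (v := w), G.dist_comm (u := t l) (v := w),
        G.dist_comm (u := v) (v := t l)] at h₆
      refine ⟨by linarith, ?_⟩
      omega
    refine ⟨s ∪ s', ?_, fun v hv => ?_⟩
    · rw [Finset.card_union_of_disjoint, hs, hs', pow_succ, mul_two]
      refine Finset.disjoint_left.2 fun v hv hv' => ?_
      have h₁ := (hsv v hv).2
      have h₂ := (hsv' v hv').2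
      have h₃ := ht.1 i
      have h₄ := ht.1 j
      have h₅ := hK (t i) v (t j) w
      rw [G.dist_comm (u := v) (v := w), G.dist_comm (u := t j) (v := w),
        G.dist_comm (u := t i) (v := w), G.dist_comm (u := v) (v := t j)] at h₅
      omega
    · rcases Finset.mem_union.1 hv with hv | hv
      · exact leg i v hi (hsv v hv).1 (hsv v hv).2
      · exact leg j v hj (hsv' v hv).1 (hsv' v hv).2

lemma FourPoint.two_pow_le_ncard_ball {K : ℕ} (hK : FourPoint G K) (hc : G.Connected)
    (hv : UnifFiniteValence G) {R C : ℕ} (hR : C + 2 * K < R)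
    (htri : ∀ w, ∃ t, IsTripod G R C w t) (x : V) (k : ℕ) :
    2 ^ k ≤ (ball G x (k * R)).ncard := by
  obtain ⟨s, hs, hsv⟩ := hK.exists_finset_two_pow hc hR htri k x x
  rw [← hs, ← Set.ncard_coe_finset]
  exact Set.ncard_le_ncard (fun v hv => (hsv v hv).1) (ball_finite hc hv x _)

end Tripods

section Lines

variable {V : Type*} {G : SimpleGraph V}

lemma exists_dist_eq [Infinite V] (hc : G.Connected) (hv : UnifFiniteValence G) (x : V) (n : ℕ) :
    ∃ y, G.dist x y = n := by
  obtain ⟨z, hz⟩ := (ball_finite hc hv x n).infinite_compl.nonempty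
  have hz' : n ≤ G.dist x z := (not_le.1 (show ¬ G.dist x z ≤ n from hz)).le
  obtain ⟨y, hy, -⟩ := exists_dist_eq_dist_eq_sub hc x z hz'
  exact ⟨y, hy⟩

/-- Finite geodesics centred at `x`, indexed by the integers. -/
lemma exists_centred_geodesic [Infinite V] (hc : G.Connected) (hv : UnifFiniteValence G)
    (ht : VertexTransitive G) (x : V) (n : ℕ) :
    ∃ g : ℤ → V, g 0 = x ∧ ∀ i j : ℤ, -n ≤ i → i ≤ j → j ≤ n →
      (G.dist (g i) (g j) : ℤ) = j - i := by
  obtain ⟨y, hy⟩ := exists_dist_eq hc hv x (2 * n)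
  obtain ⟨p, hp⟩ := exists_geodesic hc x y
  obtain ⟨φ, hφ⟩ := ht (p.getVert n) x
  refine ⟨fun i => φ (p.getVert (i + n).toNat), by simpa using hφ, fun i j hi hij hj => ?_⟩
  have hlen : p.length = 2 * n := hp.trans hy
  rw [dist_iso hc, hp.dist_getVert_getVert hc (by omega) (by omega)]
  omega

/-- An infinite, vertex-transitive, locally finite graph contains a bi-infinite geodesic. -/
lemma exists_line [Infinite V] (hc : G.Connected) (hv : UnifFiniteValence G)
    (ht : VertexTransitive G) (x : V) :
    ∃ g : ℤ → V, ∀ i j : ℤ, i ≤ j → (G.dist (g i) (g j) : ℤ) = j - i := by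
  choose g hg0 hg using exists_centred_geodesic hc hv ht x
  have large : ∀ m : ℕ, ∀ᶠ n in (hyperfilter ℕ : Filter ℕ), m ≤ n := fun m =>
    Nat.hyperfilter_le_atTop (eventually_ge_atTop m)
  have lim : ∀ i : ℤ, ∃ v, ∀ᶠ n in (hyperfilter ℕ : Filter ℕ), g n i = v := by
    intro i
    have hmem : ∀ᶠ n in (hyperfilter ℕ : Filter ℕ), ∃ v ∈ ball G x i.natAbs, g n i = v := by
      filter_upwards [large i.natAbs] with n hn
      refine ⟨g n i, ?_, rfl⟩
      change G.dist x (g n i) ≤ i.natAbs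
      rw [← hg0 n]
      rcases le_total 0 i with h | h
      · have := hg n 0 i (by omega) h (by omega)
        omega
      · have := hg n i 0 (by omega) h (by omega)
        rw [G.dist_comm] at this
        omega
    obtain ⟨v, -, h⟩ := (Ultrafilter.eventually_exists_mem_iff (ball_finite hc hv x _)).1 hmem
    exact ⟨v, h⟩
  choose γ hγ using lim
  refine ⟨γ, fun i j hij => ?_⟩
  obtain ⟨n, h₁, h₂, h₃, h₄⟩ :=
    ((hγ i).and ((hγ j).and ((large i.natAbs).and (large j.natAbs)))).exists
  rw [← h₁, ← h₂]
  exact hg n i j (by omega) hij (by omega)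

/-- A graph in a bounded neighbourhood of a bi-infinite geodesic is quasi-isometric to the
real line. -/
lemma quasiIsometricToReal_of_line (hc : G.Connected) {g : ℤ → V}
    (hg : ∀ i j : ℤ, i ≤ j → (G.dist (g i) (g j) : ℤ) = j - i) {R : ℕ}
    (hR : ∀ v, ∃ i, G.dist v (g i) ≤ R) : QuasiIsometricToReal G := by
  choose f hf using hR
  have habs : ∀ i j : ℤ, (G.dist (g i) (g j) : ℤ) = |i - j| := fun i j => by
    rcases le_total i j with h | h
    · rw [hg i j h, abs_sub_comm, abs_of_nonneg (by omega)]
    · rw [G.dist_comm, hg j i h, abs_of_nonneg (by omega)]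
  have hdist : ∀ u v, |(G.dist u v : ℤ) - (|f u - f v|)| ≤ 2 * R := fun u v => by
    have h₁ := hf u
    have h₂ := hf v
    have h₃ := hc.dist_triangle (u := u) (v := g (f u)) (w := v)
    have h₄ := hc.dist_triangle (u := g (f u)) (v := g (f v)) (w := v)
    have h₅ := hc.dist_triangle (u := g (f u)) (v := u) (w := g (f v))
    have h₆ := hc.dist_triangle (u := u) (v := v) (w := g (f v))
    rw [G.dist_comm (u := g (f v)) (v := v)] at h₄
    rw [G.dist_comm (u := g (f u)) (v := u)] at h₅
    rw [← habs (f u), abs_le]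
    omega
  have hC : (1 : ℝ) ≤ 2 * R + 1 := by
    have : (0 : ℝ) ≤ R := R.cast_nonneg
    linarith
  refine ⟨fun v => f v, 2 * R + 1, hC, fun u v => ?_, fun r => ⟨g ⌊r⌋, ?_⟩⟩
  · have h : |(G.dist u v : ℝ) - (|(f u : ℝ) - f v|)| ≤ 2 * R := by exact_mod_cast hdist u v
    have h0 : (0 : ℝ) ≤ G.dist u v := Nat.cast_nonneg _
    have h1 := div_le_self h0 hC
    rw [abs_le] at h
    constructor <;> nlinarith
  · have h : |(⌊r⌋ : ℝ) - f (g ⌊r⌋)| ≤ R := by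
      have := hf (g ⌊r⌋)
      exact_mod_cast (habs _ _).symm.le.trans (by exact_mod_cast this)
    have h1 := Int.floor_le r
    have h2 := Int.lt_floor_add_one r
    rw [abs_le] at h ⊢
    constructor <;> linarith

/-- A point far from a bi-infinite geodesic yields a tripod at its projection. -/
lemma FourPoint.exists_tripod {K : ℕ} (hK : FourPoint G K) (hc : G.Connected) {g : ℤ → V}
    (hg : ∀ i j : ℤ, i ≤ j → (G.dist (g i) (g j) : ℤ) = j - i) {R : ℕ} (hR : K < R) {v : V}
    (hv : ∀ i, R ≤ G.dist v (g i)) : ∃ w t, IsTripod G R (2 * K + 1) w t := by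
  obtain ⟨i, hi⟩ : ∃ i, ∀ j, G.dist v (g i) ≤ G.dist v (g j) :=
    ⟨Function.argmin fun i => G.dist v (g i), fun j => Function.argmin_le (fun i => G.dist v (g i)) j⟩
  obtain ⟨t, ht, htv⟩ := exists_dist_eq_dist_eq_sub hc (g i) v
    (by rw [G.dist_comm]; exact hv i : R ≤ G.dist (g i) v)
  rw [G.dist_comm (u := g i) (v := v)] at htv
  have hfar : ∀ j, R ≤ G.dist t (g j) := fun j => by
    have h₁ := hc.dist_triangle (u := v) (v := t) (w := g j)
    have h₂ := hi j
    have h₃ := hv i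
    rw [G.dist_comm (u := v) (v := t)] at h₁
    omega
  have leg : ∀ y z, G.dist (g i) y = R → G.dist (g i) z = K + 1 → G.dist y z + (K + 1) = R →
      R ≤ G.dist t z → 2 * R ≤ G.dist t y + (2 * K + 1) := by
    intro y z h₁ h₂ h₃ h₄
    have h₅ := hK (g i) t y z
    omega
  have h₁ := hg i (i + R) (by omega)
  have h₂ := hg (i - R) i (by omega)
  have h₃ := hg i (i + (K + 1)) (by omega)
  have h₄ := hg (i - (K + 1)) i (by omega)
  have h₅ := hg (i + (K + 1)) (i + R) (by omega)
  have h₆ := hg (i - R) (i - (K + 1)) (by omega)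
  have h₇ := hg (i - R) (i + R) (by omega)
  rw [G.dist_comm] at h₂ h₄ h₅
  have hplus := leg (g (i + R)) (g (i + (K + 1))) (by omega) (by omega) (by omega) (hfar _)
  have hminus := leg (g (i - R)) (g (i - (K + 1))) (by omega) (by omega) (by omega) (hfar _)
  refine ⟨g i, ![t, g (i + R), g (i - R)], fun l => ?_, fun l m hlm => ?_⟩
  · fin_cases l
    · exact ht
    · change G.dist (g i) (g (i + R)) = R
      omega
    · change G.dist (g i) (g (i - R)) = R
      omega
  · fin_cases l <;> fin_cases m <;> simp at hlm ⊢
    · exact hplus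
    · exact hminus
    · rwa [G.dist_comm]
    · rw [G.dist_comm]
      omega
    · rwa [G.dist_comm]
    · omega

end Lines

/-- a nonelementary δ-hyperbolike graph satisfies
`C⁻¹ λⁿ nᵏ ≤ |X_n| ≤ C λⁿ nᵏ` for some `λ > 1`, `C > 1`, `k ≥ 0` and all `n ≥ 1`. -/
theorem polynomial_times_exponential_growth {V : Type*} (G : SimpleGraph V) (δ : ℝ)
    (hG : Hyperbolike G δ) (x : V) (hne : Nonelementary G) :
    ∃ (lam C : ℝ) (k : ℕ), 1 < lam ∧ 1 < C ∧ ∀ n : ℕ, 1 ≤ n →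
      C⁻¹ * lam^n * (n:ℝ)^k ≤ (Nat.card (ball G x n) : ℝ) ∧
      (Nat.card (ball G x n) : ℝ) ≤ C * lam^n * (n:ℝ)^k := by
  obtain ⟨hc, hv, -, hδ, ht⟩ := hG
  obtain ⟨hinf, hqi⟩ := hne
  obtain ⟨K, hK⟩ := hδ.fourPoint hc
  obtain ⟨g, hg⟩ := exists_line hc hv ht x
  have hfar : ∃ v, ∀ i, 4 * K + 2 ≤ G.dist v (g i) := by
    by_contra! hcon
    exact hqi (quasiIsometricToReal_of_line hc hg fun v => (hcon v).imp fun i hi => hi.le)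
  obtain ⟨v, hv'⟩ := hfar
  obtain ⟨w₀, t, htri⟩ := hK.exists_tripod hc hg (by omega) hv'
  have htri' : ∀ w, ∃ t, IsTripod G (4 * K + 2) (2 * K + 1) w t := fun w => by
    obtain ⟨φ, rfl⟩ := ht w₀ w
    exact ⟨_, htri.map hc φ⟩
  obtain ⟨lam, C, hlam, hC, hb⟩ :=
    exists_pure_exponential_growth (b := fun n => ((ball G x n).ncard : ℝ))
      (fun n => by exact_mod_cast ncard_ball_pos hc hv x n)
      (fun n m => by exact_mod_cast ncard_ball_add_le hc hv ht x n m)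
      (by omega : 0 < 4 * K + 2)
      (fun k => by exact_mod_cast hK.two_pow_le_ncard_ball hc hv (by omega) htri' x k) (K + 1)
      (fun n m => by exact_mod_cast hK.ncard_ball_mul_le hc hv ht x n m)
  refine ⟨lam, C, 0, hlam, hC, fun n _ => ?_⟩
  rw [Nat.card_coe_set_eq, pow_zero, mul_one, mul_one]
  refine ⟨le_trans ?_ (hb n).1, (hb n).2⟩
  exact mul_le_of_le_one_left (by positivity) (inv_le_one_of_one_le₀ hC.le)

end CF
end
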